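/- Fix t ∈ [0,1), a* ∈ [0,1], and constants 0 < π_min ≤ π_max < ∞. Let π : [0,1] → ℝ be a probability density with π_min ≤ π(a) ≤ π_max for all a ∈ [0,1], and define ν_t(a) = (1/(1−t)) π((a − t·a*)/(1−t)) when (a − t·a*)/(1−t) ∈ [0,1] and ν_t(a) = 0 otherwise. Then ∫₀¹ (ν_t(a)/π(a))² π(a) da ≥ π_min²/((1−t) π_max). In particular, the second moment of the intervention likelihood ratio ν_t/π diverges at least at rate (1−t)^{-1} as t → 1. -/

import Mathlib

open MeasureTheory

/-- The Wasserstein intervention density on `[0,1]`: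
`ν_t(a) = (1/(1−t)) π((a − t·a*)/(1−t))` when `(a − t·a*)/(1−t) ∈ [0,1]`, else `0`. -/
noncomputable def nuT (t astar : ℝ) (pi : ℝ → ℝ) (a : ℝ) : ℝ :=
  if (a - t * astar) / (1 - t) ∈ Set.Icc (0:ℝ) 1
  then (1 / (1 - t)) * pi ((a - t * astar) / (1 - t)) else 0

theorem nuT_eq_indicator (t astar : ℝ) (pi : ℝ → ℝ) (a : ℝ) :
    nuT t astar pi a =
      (1 / (1 - t)) * (Set.Icc (0:ℝ) 1).indicator pi ((a - t * astar) / (1 - t)) := by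
  unfold nuT Set.indicator
  split_ifs <;> simp

theorem integrable_nuT {t : ℝ} (ht : t < 1) (astar : ℝ) {pi : ℝ → ℝ}
    (hpi : IntegrableOn pi (Set.Icc (0:ℝ) 1)) : Integrable (nuT t astar pi) := by
  have hg : Integrable ((Set.Icc (0:ℝ) 1).indicator pi) :=
    (integrable_indicator_iff measurableSet_Icc).2 hpi
  have h := ((hg.comp_div (sub_pos.2 ht).ne').comp_sub_right (t * astar)).const_mul (1 / (1 - t))
  exact h.congr (Filter.Eventually.of_forall fun a => (nuT_eq_indicator t astar pi a).symm)

theorem nuT_nonneg_le {t πmin πmax : ℝ} (ht : t < 1) (astar : ℝ) {pi : ℝ → ℝ}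
    (hπmin : 0 < πmin) (hminmax : πmin ≤ πmax)
    (hpi_bd : ∀ a ∈ Set.Icc (0:ℝ) 1, πmin ≤ pi a ∧ pi a ≤ πmax) (a : ℝ) :
    0 ≤ nuT t astar pi a ∧ nuT t astar pi a ≤ 1 / (1 - t) * πmax := by
  have h1 : 0 < 1 - t := sub_pos.2 ht
  have hmax : 0 < πmax := hπmin.trans_le hminmax
  unfold nuT
  split_ifs with h
  · obtain ⟨hl, hu⟩ := hpi_bd _ h
    have := hπmin.trans_le hl
    exact ⟨by positivity, by gcongr⟩
  · exact ⟨le_rfl, by positivity⟩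

/-- the second moment of the intervention likelihood ratio `ν_t/π` under
`π` is at least `π_min²/((1−t)π_max)`, so it diverges at rate `(1−t)⁻¹` as `t → 1`. -/
theorem stmt_11 (t astar : ℝ) (ht : t ∈ Set.Ico (0:ℝ) 1)
    (hastar : astar ∈ Set.Icc (0:ℝ) 1)
    (πmin πmax : ℝ) (hπmin : 0 < πmin) (hminmax : πmin ≤ πmax)
    (pi : ℝ → ℝ) (hpi_dens : ∫ a in (0:ℝ)..1, pi a = 1)
    (hpi_bd : ∀ a ∈ Set.Icc (0:ℝ) 1, πmin ≤ pi a ∧ pi a ≤ πmax) :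
    πmin^2 / ((1 - t) * πmax)
      ≤ ∫ a in (0:ℝ)..1, (nuT t astar pi a / pi a)^2 * pi a := by
  obtain ⟨ht0, ht1⟩ := ht
  obtain ⟨ha0, ha1⟩ := hastar
  have h1 : 0 < 1 - t := sub_pos.2 ht1
  have hmax : 0 < πmax := hπmin.trans_le hminmax
  have hpi : IntegrableOn pi (Set.Icc (0:ℝ) 1) := by
    rw [← intervalIntegrable_iff_integrableOn_Icc_of_le zero_le_one]
    by_contra h
    rw [intervalIntegral.integral_undef h] at hpi_dens
    exact zero_ne_one hpi_dens
  rw [intervalIntegral.integral_of_le zero_le_one, ← integral_Icc_eq_integral_Ioc]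
  have hint : IntegrableOn (fun a => (nuT t astar pi a / pi a) ^ 2 * pi a)
      (Set.Icc (0:ℝ) 1) := by
    refine Integrable.of_bound ?_ ((1 / (1 - t) * πmax / πmin) ^ 2 * πmax) ?_
    · have hν := (integrable_nuT ht1 astar hpi).aestronglyMeasurable.aemeasurable.restrict
        (s := Set.Icc (0:ℝ) 1)
      have hp := hpi.aestronglyMeasurable.aemeasurable
      exact (((hν.div hp).pow_const 2).mul hp).aestronglyMeasurable
    · filter_upwards [ae_restrict_mem measurableSet_Icc] with a ha
      obtain ⟨hl, hu⟩ := hpi_bd a ha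
      obtain ⟨hν0, hν1⟩ := nuT_nonneg_le ht1 astar hπmin hminmax hpi_bd a
      have hpos := hπmin.trans_le hl
      rw [Real.norm_of_nonneg (by positivity)]
      gcongr
  set J : Set ℝ := Set.Icc (t * astar) (t * astar + (1 - t)) with hJ
  have hJsub : J ⊆ Set.Icc 0 1 := Set.Icc_subset_Icc (by positivity) (by nlinarith)
  set c : ℝ := (1 / (1 - t) * πmin) ^ 2 / πmax with hc
  calc πmin ^ 2 / ((1 - t) * πmax) = ∫ _ in J, c := by
        rw [setIntegral_const, hJ, Real.volume_real_Icc_of_le (by linarith), hc]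
        simp only [smul_eq_mul]
        field_simp
        ring
    _ ≤ ∫ a in J, (nuT t astar pi a / pi a) ^ 2 * pi a := by
        refine setIntegral_mono_on (integrableOn_const measure_Icc_lt_top.ne)
          (hint.mono_set hJsub) measurableSet_Icc fun a ha => ?_
        have hmem : (a - t * astar) / (1 - t) ∈ Set.Icc (0:ℝ) 1 :=
          ⟨div_nonneg (by linarith [ha.1]) h1.le, (div_le_one h1).2 (by linarith [ha.2])⟩
        obtain ⟨hl, hu⟩ := hpi_bd a (hJsub ha)
        have hpos := hπmin.trans_le hl
        have hν : 1 / (1 - t) * πmin ≤ nuT t astar pi a := by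
          rw [nuT, if_pos hmem]
          have := (hpi_bd _ hmem).1
          gcongr
        have heq : (nuT t astar pi a / pi a) ^ 2 * pi a = nuT t astar pi a ^ 2 / pi a := by
          field_simp
        rw [heq, hc]
        gcongr
    _ ≤ ∫ a in Set.Icc (0:ℝ) 1, (nuT t astar pi a / pi a) ^ 2 * pi a := by
        refine setIntegral_mono_set hint ?_ hJsub.eventuallyLE
        filter_upwards [ae_restrict_mem measurableSet_Icc] with a ha
        exact mul_nonneg (sq_nonneg _) (hπmin.le.trans (hpi_bd a ha).1)
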